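/- arXiv:1008.4299 — 3 statements merged into one kernel-verified Lean document; each statement's English description precedes it below -/
import Mathlib

section
/- Let X be a finite type, n a natural number, and σ a permutation of Fin n. Then the number of σ-invariant tuples f : Fin n → X (i.e., with f ∘ σ = f) equals (card X)^m, where m = (n − σ.support.card) + Multiset.card σ.cycleType is the number of orbits of σ on Fin n, i.e., m = ∑_{r=1}^n k_r(σ). -/
open Equiv Equiv.Perm in
theorem fixedTuples_aux_zpow {X α : Type*} (σ : Equiv.Perm α) (f : α → X) (hf : f ∘ σ = f)
    {x y : α} (h : σ.SameCycle x y) : f x = f y := by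
  obtain ⟨i, rfl⟩ := h
  have h1 : ∀ z, f (σ z) = f z := fun z => congrFun hf z
  have h2 : ∀ z, f (σ⁻¹ z) = f z := fun z => by
    rw [← h1 (σ⁻¹ z)]; simp
  induction i with
  | zero => simp
  | succ i ih => rw [add_comm, zpow_add, zpow_one, Equiv.Perm.mul_apply, h1]; exact ih
  | pred i ih =>
    rw [sub_eq_add_neg, add_comm, zpow_add, zpow_neg_one, Equiv.Perm.mul_apply, h2]; exact ih

/-- The map sending a point to its orbit: a fixed point or a cycle factor. -/
def fixedTuplesOrb {n : ℕ} (σ : Equiv.Perm (Fin n)) (x : Fin n) :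
    {x // x ∈ σ.supportᶜ} ⊕ {c // c ∈ σ.cycleFactorsFinset} :=
  if h : x ∈ σ.support then
    Sum.inr ⟨σ.cycleOf x, Equiv.Perm.cycleOf_mem_cycleFactorsFinset_iff.2 h⟩
  else Sum.inl ⟨x, Finset.mem_compl.2 h⟩

theorem fixedTuplesOrb_surj {n : ℕ} (σ : Equiv.Perm (Fin n)) :
    Function.Surjective (fixedTuplesOrb σ) := by
  rintro (⟨x, hx⟩ | ⟨c, hc⟩)
  · exact ⟨x, by simp [fixedTuplesOrb, Finset.mem_compl.1 hx, -Equiv.Perm.mem_support]⟩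
  · obtain ⟨x, hx⟩ := (Equiv.Perm.mem_cycleFactorsFinset_iff.1 hc).1.nonempty_support
    have hs : x ∈ σ.support := Equiv.Perm.mem_cycleFactorsFinset_support_le hc hx
    refine ⟨x, ?_⟩
    have := Equiv.Perm.cycle_is_cycleOf hx hc
    simp [fixedTuplesOrb, hs, -Equiv.Perm.mem_support, ← this]

theorem fixedTuplesOrb_sameCycle {n : ℕ} (σ : Equiv.Perm (Fin n)) {x y : Fin n}
    (h : fixedTuplesOrb σ x = fixedTuplesOrb σ y) : σ.SameCycle x y := by
  unfold fixedTuplesOrb at h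
  split_ifs at h with hx hy hy
  · have h' : σ.cycleOf x = σ.cycleOf y := by simpa using h
    have hy' : y ∈ (σ.cycleOf y).support := by
      rw [Equiv.Perm.mem_support_cycleOf_iff]; exact ⟨Equiv.Perm.SameCycle.refl _ _, hy⟩
    rw [← h', Equiv.Perm.mem_support_cycleOf_iff] at hy'
    exact hy'.1
  · have h' : x = y := by simpa using h
    exact h' ▸ Equiv.Perm.SameCycle.refl _ _

theorem fixedTuplesOrb_apply {n : ℕ} (σ : Equiv.Perm (Fin n)) (x : Fin n) :
    fixedTuplesOrb σ (σ x) = fixedTuplesOrb σ x := by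
  by_cases hx : x ∈ σ.support
  · have hx' : σ x ∈ σ.support := Equiv.Perm.apply_mem_support.2 hx
    have : σ.cycleOf (σ x) = σ.cycleOf x :=
      (Equiv.Perm.SameCycle.cycleOf_eq (Equiv.Perm.sameCycle_apply_left.2
        (Equiv.Perm.SameCycle.refl σ x)))
    simp only [fixedTuplesOrb, hx, hx', dif_pos, this]
  · rw [Equiv.Perm.notMem_support.1 hx]

/-- For a finite type `X` and a permutation `σ` of `Fin n`, the number of
`σ`-invariant tuples `f : Fin n → X` equals `(card X)^m`, where
`m = (n - σ.support.card) + Multiset.card σ.cycleType` is the number of orbits of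
`σ` on `Fin n`. -/
theorem card_fixedTuples (X : Type*) [Fintype X] (n : ℕ) (σ : Equiv.Perm (Fin n)) :
    Nat.card {f : Fin n → X // f ∘ σ = f} =
      Fintype.card X ^ ((n - σ.support.card) + Multiset.card σ.cycleType) := by
  let F : ({x // x ∈ σ.supportᶜ} ⊕ {c // c ∈ σ.cycleFactorsFinset} → X) →
      {f : Fin n → X // f ∘ σ = f} := fun h =>
    ⟨h ∘ fixedTuplesOrb σ, by
      funext x
      simp only [Function.comp_apply, fixedTuplesOrb_apply]⟩
  have hF : Function.Bijective F := by
    constructor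
    · intro a b hab
      exact (fixedTuplesOrb_surj σ).injective_comp_right (congrArg Subtype.val hab)
    · rintro ⟨f, hf⟩
      refine ⟨fun o => f (Function.surjInv (fixedTuplesOrb_surj σ) o), Subtype.ext ?_⟩
      funext x
      exact fixedTuples_aux_zpow σ f hf
        (fixedTuplesOrb_sameCycle σ (Function.surjInv_eq (fixedTuplesOrb_surj σ) _))
  rw [← Nat.card_congr (Equiv.ofBijective F hF), Nat.card_fun, Nat.card_sum,
    Nat.card_eq_fintype_card, Nat.card_eq_fintype_card, Nat.card_eq_fintype_card,
    Fintype.card_coe, Fintype.card_coe, Finset.card_compl, Fintype.card_fin,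
    Equiv.Perm.cycleType_def, Multiset.card_map, Finset.card_val]
end

section
/- Let K be a field, V a finite-dimensional K-vector space, n a natural number, and σ a permutation of Fin n. Let P_σ be the linear automorphism of the n-fold tensor power ⨂_{i : Fin n} V given by permuting the tensor factors according to σ. Then the trace of P_σ equals (dim_K V)^m, where m is the number of orbits of σ on Fin n, i.e., m = (n − σ.support.card) + Multiset.card σ.cycleType. -/
open scoped TensorProduct

theorem card_orbits_aux {n : ℕ} (σ : Equiv.Perm (Fin n)) :
    Nat.card (Quotient (Equiv.Perm.SameCycle.setoid σ)) =
      (n - σ.support.card) + Multiset.card σ.cycleType := by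
  classical
  have hne : ∀ c : σ.cycleFactorsFinset, ∃ x, x ∈ (c : Equiv.Perm (Fin n)).support := by
    intro c
    have h := (Equiv.Perm.mem_cycleFactorsFinset_iff.1 c.2).1
    exact Finset.card_pos.1 (by have := h.two_le_card_support; omega)
  choose r hr using hne
  have hrs : ∀ c, r c ∈ σ.support := fun c =>
    Equiv.Perm.mem_cycleFactorsFinset_support_le c.2 (hr c)
  have hrc : ∀ c : σ.cycleFactorsFinset, (c : Equiv.Perm (Fin n)) = σ.cycleOf (r c) := fun c =>
    Equiv.Perm.cycle_is_cycleOf (hr c) c.2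
  let g : {x // x ∈ σ.supportᶜ} ⊕ σ.cycleFactorsFinset →
      Quotient (Equiv.Perm.SameCycle.setoid σ) :=
    Sum.elim (fun x => Quotient.mk _ x.1) (fun c => Quotient.mk _ (r c))
  have hfix : ∀ x y : Fin n, x ∉ σ.support → σ.SameCycle x y → x = y := by
    intro x y hx h
    obtain ⟨i, hi⟩ := h
    rw [Equiv.Perm.notMem_support] at hx
    rw [← hi, Equiv.Perm.zpow_apply_eq_self_of_apply_eq_self hx]
  have hg : Function.Bijective g := by
    constructor
    · rintro (⟨x, hx⟩ | c) (⟨y, hy⟩ | d) h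
      · have h' : σ.SameCycle x y := Quotient.exact h
        have := hfix x y (by simpa using hx) h'
        subst this; rfl
      · have h' : σ.SameCycle x (r d) := Quotient.exact h
        have := hfix _ _ (by simpa using hx) h'
        exact absurd (hrs d) (by rw [← this]; simpa using hx)
      · have h' : σ.SameCycle (r c) y := Quotient.exact h
        have := hfix _ _ (by simpa using hy) h'.symm
        exact absurd (hrs c) (by rw [← this]; simpa using hy)
      · have h' : σ.SameCycle (r c) (r d) := Quotient.exact h
        congr 1
        apply Subtype.ext
        rw [hrc c, hrc d, h'.cycleOf_eq]
    · intro q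
      induction q using Quotient.inductionOn with
      | h x =>
        by_cases hx : x ∈ σ.support
        · refine ⟨Sum.inr ⟨σ.cycleOf x, Equiv.Perm.cycleOf_mem_cycleFactorsFinset_iff.2 hx⟩, ?_⟩
          apply Quotient.sound
          have := hr ⟨σ.cycleOf x, Equiv.Perm.cycleOf_mem_cycleFactorsFinset_iff.2 hx⟩
          exact ((Equiv.Perm.mem_support_cycleOf_iff.1 this).1).symm
        · exact ⟨Sum.inl ⟨x, by simpa using hx⟩, rfl⟩
  rw [← Nat.card_congr (Equiv.ofBijective g hg), Nat.card_sum, Nat.card_eq_fintype_card,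
    Nat.card_eq_fintype_card, Fintype.card_coe, Fintype.card_coe, Finset.card_compl,
    Fintype.card_fin, Equiv.Perm.cycleType_def, Multiset.card_map]
  rfl

theorem card_invariant_aux {n d : ℕ} (σ : Equiv.Perm (Fin n)) :
    Nat.card {p : Fin n → Fin d // ∀ i, p (σ i) = p i} =
      d ^ ((n - σ.support.card) + Multiset.card σ.cycleType) := by
  classical
  rw [← card_orbits_aux]
  have hinv : ∀ p : Fin n → Fin d, (∀ i, p (σ i) = p i) →
      ∀ a b, σ.SameCycle a b → p a = p b := by
    intro p hp a b h
    obtain ⟨k, -, hk⟩ := h.exists_pow_eq'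
    rw [← hk]
    clear hk
    induction k with
    | zero => rfl
    | succ k ih => rw [pow_succ', Equiv.Perm.mul_apply, hp, ih]
  let e : {p : Fin n → Fin d // ∀ i, p (σ i) = p i} ≃
      (Quotient (Equiv.Perm.SameCycle.setoid σ) → Fin d) :=
    { toFun := fun p => Quotient.lift p.1 (hinv p.1 p.2)
      invFun := fun q => ⟨fun i => q (Quotient.mk _ i), fun i => congrArg q (Quotient.sound
        (show σ.SameCycle (σ i) i from
          Equiv.Perm.sameCycle_apply_left.2 (Equiv.Perm.SameCycle.refl _ _)))⟩
      left_inv := fun p => rfl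
      right_inv := fun q => by
        funext x
        induction x using Quotient.inductionOn with
        | h x => rfl }
  rw [Nat.card_congr e, Nat.card_fun, Nat.card_fin]

/-- For a permutation `σ` of `Fin n`, the trace of the linear automorphism of the
`n`-fold tensor power `⨂_{i : Fin n} V` permuting the tensor factors according to
`σ` equals `(dim_K V)^m`, where `m = (n - σ.support.card) + Multiset.card σ.cycleType`
is the number of orbits of `σ` on `Fin n`. -/
theorem trace_permutation_tensorPower (K : Type*) [Field K]
    (V : Type*) [AddCommGroup V] [Module K V] [FiniteDimensional K V]
    (n : ℕ) (σ : Equiv.Perm (Fin n)) :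
    LinearMap.trace K _
        (PiTensorProduct.reindex K (fun _ : Fin n => V) σ).toLinearMap =
      (Module.finrank K V : K) ^
        ((n - σ.support.card) + Multiset.card σ.cycleType) := by
  classical
  let b := Module.finBasis K V
  let B := Basis.piTensorProduct (fun _ : Fin n => b)
  have key : ∀ p : Fin n → Fin (Module.finrank K V),
      B.repr ((PiTensorProduct.reindex K (fun _ : Fin n => V) σ) (B p)) p =
        if ∀ i, p (σ i) = p i then 1 else 0 := by
    intro p
    have h1 : (PiTensorProduct.reindex K (fun _ : Fin n => V) σ) (B p) =
        PiTensorProduct.tprod K (fun i => b (p (σ.symm i))) := by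
      rw [Basis.piTensorProduct_apply]
      exact PiTensorProduct.reindex_tprod σ (fun i => b (p i))
    rw [h1, Basis.piTensorProduct_repr_tprod_apply]
    simp only [Module.Basis.repr_self, Finsupp.single_apply]
    rw [Finset.prod_ite_zero]
    simp only [Finset.mem_univ, forall_const, Finset.prod_const_one]
    congr 1
    apply propext
    constructor
    · intro h i
      simpa using (h (σ i)).symm
    · intro h i
      simpa using (h (σ.symm i)).symm
  rw [LinearMap.trace_eq_matrix_trace K B, Matrix.trace]
  simp only [Matrix.diag_apply, LinearMap.toMatrix_apply]
  refine (Finset.sum_congr rfl fun p _ => key p).trans ?_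
  rw [Finset.sum_boole, ← Nat.cast_pow, ← card_invariant_aux σ, Nat.card_eq_fintype_card,
    Fintype.card_subtype]
end

section
/- Let α be a nonzero real number and r ≥ 1 a natural number. Then, as y tends to 1 within the reals y ≠ 1, the function y ↦ α·(1 − y^r·exp(−r·α·(1−y))) / (1 − exp(−r·α·(1−y))) tends to 1 + α. (This l'Hôpital-type limit shows that the normalized r-th Adams-transformed Hirzebruch class power series specializes at y = 1 to the total Chern class power series 1 + α, independently of r.) -/
open Real Filter

/-- For `α ≠ 0` and `r ≥ 1`, as `y → 1` (with `y ≠ 1`), the normalized `r`-th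
Adams-transformed Hirzebruch class power series
`α(1 − yʳ e^{−rα(1−y)})/(1 − e^{−rα(1−y)})` tends to the total Chern class power
series `1 + α`, independently of `r`. -/
theorem tendsto_adams_hirzebruch_to_chern (α : ℝ) (hα : α ≠ 0) (r : ℕ) (hr : 1 ≤ r) :
    Tendsto
      (fun y : ℝ =>
        α * (1 - y ^ r * Real.exp (-(r : ℝ) * α * (1 - y))) /
          (1 - Real.exp (-(r : ℝ) * α * (1 - y))))
      (nhdsWithin 1 {(1 : ℝ)}ᶜ) (nhds (1 + α)) := by
  have hr0 : (r : ℝ) ≠ 0 := by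
    exact_mod_cast (by omega : r ≠ 0)
  have hE : HasDerivAt (fun y : ℝ => Real.exp (-(r : ℝ) * α * (1 - y))) ((r : ℝ) * α) 1 := by
    have h := (((hasDerivAt_id (1 : ℝ)).const_sub 1).const_mul (-(r : ℝ) * α)).exp
    simpa using h
  have hD := hE.const_sub 1
  have hN := ((((hasDerivAt_pow r (1 : ℝ)).mul hE).const_sub 1).const_mul α)
  have h := (hasDerivAt_iff_tendsto_slope.1 hN).div (hasDerivAt_iff_tendsto_slope.1 hD)
    (neg_ne_zero.2 (mul_ne_zero hr0 hα))
  have hv : (α * -((r : ℝ) * 1 ^ (r - 1) * Real.exp (-(r : ℝ) * α * (1 - 1))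
      + 1 ^ r * ((r : ℝ) * α))) / (-((r : ℝ) * α)) = 1 + α := by
    simp only [sub_self, mul_zero, Real.exp_zero, one_pow]
    field_simp
  rw [hv] at h
  refine h.congr' ?_
  filter_upwards [self_mem_nhdsWithin] with y hy
  have hy' : (y - 1)⁻¹ ≠ 0 := inv_ne_zero (sub_ne_zero.2 hy)
  simp only [Pi.div_apply, Pi.mul_apply, slope_def_module, smul_eq_mul]
  rw [mul_div_mul_left _ _ hy']
  simp
end
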